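/- arXiv:2207.07393 — 3 statements merged into one kernel-verified Lean document; each statement's English description precedes it below -/
import Mathlib

section
/- Let p₂ > 3 be a prime with p₂ ≡ 1 (mod 3), set q₂ = (p₂ − 1)/3 (which is even), and let p₃ be a prime with p₃ > 3p₂ and p₃ ≡ 2 (mod 3p₂). Let i = 3u with i < p₂ − 1. Then hw(f_{3p₂,p₃,i,0}) = 8u + 6 if 0 ≤ u ≤ q₂/2 − 1, and hw(f_{3p₂,p₃,i,0}) = 4u + 2q₂ + 2 if q₂/2 ≤ u ≤ q₂ − 1. -/
open Polynomial

/-- The Hamming weight of a polynomial: its number of nonzero coefficients. -/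
noncomputable def hw (f : Polynomial ℤ) : ℕ := f.support.card

/-- The block `f_{m,p,i,0}`: the polynomial of degree `< m` whose coefficient of `x^k`
is the coefficient of `x^(i*p + k)` in `Φ_{mp}`, for `0 ≤ k < m`. -/
noncomputable def blockPoly (m p i : ℕ) : Polynomial ℤ :=
  ∑ k ∈ Finset.range m, C ((cyclotomic (m * p) ℤ).coeff (i * p + k)) * X ^ k

/-- coefficients of `Φ_{3p}` below degree `p`. -/
def aCo (j : ℕ) : ℤ := if j % 3 = 0 then 1 else if j % 3 = 1 then -1 else 0

/-- indicator of `{0,1,2}`. -/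
def ind3 (t : ℤ) : ℤ := if 0 ≤ t ∧ t ≤ 2 then 1 else 0

/-- one period of the coefficients of `1/Φ_{3p}`. -/
def beta (p : ℕ) (t : ℤ) : ℤ := ind3 t - ind3 (t - p)

/-- closed form of the convolution. -/
def gg (u : ℕ) (t : ℤ) : ℤ :=
  if t < 0 ∨ 6 * u + 2 < t then 0 else if t = 6 * u + 2 then 1
  else if t % 6 = 0 ∨ t % 6 = 1 then 1 else if t % 6 = 3 ∨ t % 6 = 4 then -1 else 0

lemma sum_gg (u : ℕ) (t : ℤ) :
    ∑ j ∈ Finset.range (3 * u + 1), aCo j * ind3 (t - 2 * j) = gg u t := by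
  induction u with
  | zero =>
    simp [aCo, ind3, gg]
    split_ifs <;> omega
  | succ u ih =>
    rw [show 3 * (u + 1) + 1 = 3 * u + 1 + 1 + 1 + 1 by ring, Finset.sum_range_succ,
      Finset.sum_range_succ, Finset.sum_range_succ, ih]
    have h1 : aCo (3 * u + 1) = -1 := by unfold aCo; split_ifs <;> omega
    have h2 : aCo (3 * u + 1 + 1) = 0 := by unfold aCo; split_ifs <;> omega
    have h3 : aCo (3 * u + 1 + 1 + 1) = 1 := by unfold aCo; split_ifs <;> omega
    rw [h1, h2, h3]
    simp only [ind3, gg]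
    push_cast
    split_ifs <;> omega

lemma cyc_mul (p : ℕ) (hp : p.Prime) (h3 : 3 < p) :
    cyclotomic (3 * p) ℤ * (1 + X + X ^ 2) = 1 + X ^ p + X ^ (2 * p) := by
  have h := cyclotomic_expand_eq_cyclotomic_mul hp (n := 3)
    (by intro h; exact absurd (Nat.le_of_dvd (by norm_num) h) (by omega)) ℤ
  rw [cyclotomic_three] at h
  simp only [map_add, map_pow, expand_X, map_one] at h
  rw [pow_mul', show (1 + X + X ^ 2 : ℤ[X]) = X ^ 2 + X + 1 by ring, ← h]
  ring

lemma coeff_small (p : ℕ) (hp : p.Prime) (h3 : 3 < p) (j : ℕ) (hj : j < p) :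
    (cyclotomic (3 * p) ℤ).coeff j = aCo j := by
  have h := cyc_mul p hp h3
  induction j using Nat.strong_induction_on with
  | _ j ih =>
    have hc := congrArg (fun f : ℤ[X] => f.coeff j) h
    simp only [mul_add, mul_one, coeff_add, coeff_one, coeff_X_pow, coeff_mul_X_pow'] at hc
    rw [if_neg (show ¬ j = p by omega), if_neg (show ¬ j = 2 * p by omega)] at hc
    match j, ih, hc with
    | 0, ih, hc => simpa [aCo] using hc
    | 1, ih, hc =>
      have h0 := ih 0 (by omega) (by omega)
      rw [← zero_add 1, coeff_mul_X] at hc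
      simp [h0, aCo] at hc ⊢
      omega
    | j + 2, ih, hc =>
      have h0 := ih j (by omega) (by omega)
      have h1 := ih (j + 1) (by omega) (by omega)
      rw [coeff_mul_X] at hc
      simp [h0, h1] at hc
      have : (cyclotomic (3 * p) ℤ).coeff (j + 2) = - (aCo (j + 1) + aCo j) := by linarith
      rw [this]
      unfold aCo
      split_ifs <;> omega

/-- power series `1/Φ_{3p}`. -/
noncomputable def BB (p : ℕ) : PowerSeries ℤ := PowerSeries.mk fun N => beta p ((N % (3 * p) : ℕ) : ℤ)

lemma BB_mul (p : ℕ) (h3 : 3 < p) :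
    BB p * (1 - PowerSeries.X ^ (3 * p)) =
      (1 + PowerSeries.X + PowerSeries.X ^ 2) * (1 - PowerSeries.X ^ p) := by
  have : ((1 + PowerSeries.X + PowerSeries.X ^ 2) * (1 - PowerSeries.X ^ p) : PowerSeries ℤ)
    = PowerSeries.X ^ 0 + PowerSeries.X ^ 1 + PowerSeries.X ^ 2 - PowerSeries.X ^ p -
      PowerSeries.X ^ (p + 1) - PowerSeries.X ^ (p + 2) := by ring
  rw [this]
  ext N
  rw [mul_sub, mul_one]
  simp only [map_sub, map_add, PowerSeries.coeff_X_pow, PowerSeries.coeff_mul_X_pow', BB,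
    PowerSeries.coeff_mk]
  by_cases hN : 3 * p ≤ N
  · rw [if_pos hN, ← Nat.mod_eq_sub_mod hN]
    rw [if_neg, if_neg, if_neg, if_neg, if_neg, if_neg] <;> omega
  · rw [if_neg hN, Nat.mod_eq_of_lt (by omega)]
    simp only [beta, ind3]
    split_ifs <;> omega

lemma cyc_BB (p : ℕ) (hp : p.Prime) (h3 : 3 < p) :
    (cyclotomic (3 * p) ℤ : PowerSeries ℤ) * BB p = 1 := by
  have h := congrArg (fun f : ℤ[X] => (f : PowerSeries ℤ)) (cyc_mul p hp h3)
  simp only [Polynomial.coe_mul, Polynomial.coe_add, Polynomial.coe_one, Polynomial.coe_X,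
    Polynomial.coe_pow] at h
  have hb := BB_mul p h3
  have hne : (1 - PowerSeries.X ^ (3 * p) : PowerSeries ℤ) ≠ 0 := by
    intro h0
    have := congrArg (PowerSeries.coeff 0) h0
    have hp0 : p ≠ 0 := by omega
    simp [hp0] at this
  apply mul_right_cancel₀ hne
  rw [mul_assoc, hb, ← mul_assoc, h]
  ring

lemma coeff_main (p r : ℕ) (hp : p.Prime) (h3 : 3 < p) (hr : r.Prime) (hgt : 3 * p < r)
    (i k : ℕ) (hk : k < 3 * p) :
    (cyclotomic (3 * p * r) ℤ).coeff (i * r + k) =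
      ∑ j ∈ Finset.range (i + 1), (cyclotomic (3 * p) ℤ).coeff j *
        beta p ((((i - j) * r + k) % (3 * p) : ℕ) : ℤ) := by
  have h := cyclotomic_expand_eq_cyclotomic_mul hr (n := 3 * p)
    (by intro h; exact absurd (Nat.le_of_dvd (by omega) h) (by omega)) ℤ
  have h2 := congrArg (fun f : ℤ[X] => (f : PowerSeries ℤ) * BB p) h
  simp only [Polynomial.coe_mul] at h2
  rw [mul_assoc, cyc_BB p hp h3, mul_one] at h2
  rw [← Polynomial.coeff_coe, ← h2, PowerSeries.coeff_mul]
  have hr0 : 0 < r := hr.pos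
  rw [Finset.Nat.sum_antidiagonal_eq_sum_range_succ (fun a b => 
    (PowerSeries.coeff a) ((expand ℤ r (cyclotomic (3 * p) ℤ) : ℤ[X]) : PowerSeries ℤ) *
      (PowerSeries.coeff b) (BB p))]
  simp only [Polynomial.coeff_coe, coeff_expand hr0, BB, PowerSeries.coeff_mk]
  symm
  apply Finset.sum_of_injOn (fun j => j * r)
  · intro a _ b _ hab
    exact Nat.eq_of_mul_eq_mul_right hr0 hab
  · intro j hj
    simp only [Finset.coe_range, Set.mem_Iio] at hj ⊢
    have : j * r ≤ i * r := Nat.mul_le_mul_right _ (by omega)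
    show j * r < _
    omega
  · intro N hN hn
    rw [if_neg, zero_mul]
    rintro ⟨j, rfl⟩
    apply hn
    simp only [Finset.coe_range, Set.mem_image, Set.mem_Iio, Finset.mem_range] at hN ⊢
    refine ⟨j, ?_, mul_comm _ _⟩
    by_contra hc
    have : (i + 1) * r ≤ j * r := Nat.mul_le_mul_right _ (by omega)
    nlinarith
  · intro j hj
    simp only [Finset.mem_range] at hj
    rw [if_pos (Dvd.intro_left _ rfl), Nat.mul_div_cancel _ hr0]
    congr 4
    obtain ⟨d, rfl⟩ : ∃ d, i = j + d := ⟨i - j, by omega⟩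
    rw [Nat.add_sub_cancel_left, add_mul, add_assoc, Nat.add_sub_cancel_left]

lemma coeff_final (p r : ℕ) (hp : p.Prime) (h3 : 3 < p) (hr : r.Prime) (hgt : 3 * p < r)
    (hmod : r % (3 * p) = 2) (u k : ℕ) (hu : 3 * u + 1 < p) (hp1 : p % 3 = 1)
    (hk : k < 3 * p) :
    (cyclotomic (3 * p * r) ℤ).coeff (3 * u * r + k) =
      gg u (((k + 6 * u) % (3 * p) : ℕ) : ℤ) - gg u ((((k + 6 * u) % (3 * p) : ℕ) : ℤ) - p) := by
  rw [coeff_main p r hp h3 hr hgt _ _ hk, ← sum_gg, ← sum_gg, ← Finset.sum_sub_distrib]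
  apply Finset.sum_congr rfl
  intro j hj
  simp only [Finset.mem_range] at hj
  rw [coeff_small p hp h3 j (by omega), ← mul_sub]
  congr 1
  obtain ⟨d, hd⟩ : ∃ d, 3 * u = j + d := ⟨3 * u - j, by omega⟩
  have e1 : ((3 * u - j) * r + k) % (3 * p) = (2 * d + k) % (3 * p) := by
    rw [hd, Nat.add_sub_cancel_left, Nat.add_mod, Nat.mul_mod, hmod, ← Nat.mul_mod_mod]
    simp [mul_comm]
  rw [e1]
  have e2 : k + 6 * u = 2 * d + k + 2 * j := by omega
  rw [e2]
  have e3 : (2 * d + k) % (3 * p) = 2 * d + k ∨ (2 * d + k) % (3 * p) + 3 * p = 2 * d + k := by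
    by_cases hlt : 2 * d + k < 3 * p
    · left; exact Nat.mod_eq_of_lt hlt
    · right; rw [Nat.mod_eq_sub_mod (by omega), Nat.mod_eq_of_lt (by omega)]; omega
  have e4 : (2 * d + k + 2 * j) % (3 * p) = 2 * d + k + 2 * j ∨
      (2 * d + k + 2 * j) % (3 * p) + 3 * p = 2 * d + k + 2 * j := by
    by_cases hlt : 2 * d + k + 2 * j < 3 * p
    · left; exact Nat.mod_eq_of_lt hlt
    · right; rw [Nat.mod_eq_sub_mod (by omega), Nat.mod_eq_of_lt (by omega)]; omega
  have b1 : (2 * d + k) % (3 * p) < 3 * p := Nat.mod_lt _ (by omega)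
  have b2 : (2 * d + k + 2 * j) % (3 * p) < 3 * p := Nat.mod_lt _ (by omega)
  generalize (2 * d + k) % (3 * p) = A at *
  generalize (2 * d + k + 2 * j) % (3 * p) = B at *
  simp only [beta, ind3]
  rcases e3 with e3 | e3 <;> rcases e4 with e4 | e4 <;> split_ifs <;> omega

/-- rotated coefficient sequence. -/
def HH (p u : ℕ) (e : ℕ) : ℤ := gg u e - gg u ((e : ℤ) - p)

instance (p u : ℕ) : DecidablePred (fun e => HH p u e ≠ 0) := fun _ => inferInstance

lemma hw_eq (p r : ℕ) (hp : p.Prime) (h3 : 3 < p) (hr : r.Prime) (hgt : 3 * p < r)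
    (hmod : r % (3 * p) = 2) (u : ℕ) (hu : 3 * u + 1 < p) (hp1 : p % 3 = 1) :
    hw (blockPoly (3 * p) r (3 * u)) = Nat.count (fun e => HH p u e ≠ 0) (3 * p) := by
  rw [Nat.count_eq_card_filter_range, hw]
  have hc : ∀ k, (blockPoly (3 * p) r (3 * u)).coeff k =
      if k < 3 * p then HH p u ((k + 6 * u) % (3 * p)) else 0 := by
    intro k
    simp only [blockPoly, finsetSum_coeff, coeff_C_mul_X_pow]
    rw [Finset.sum_ite_eq]
    simp only [Finset.mem_range]
    split_ifs with hk
    · rw [coeff_final p r hp h3 hr hgt hmod u k hu hp1 hk]; rfl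
    · rfl
  apply Finset.card_bij (fun k _ => (k + 6 * u) % (3 * p))
  · intro k hk
    rw [mem_support_iff, hc] at hk
    simp only [Finset.mem_filter, Finset.mem_range]
    refine ⟨Nat.mod_lt _ (by omega), ?_⟩
    intro h0; rw [h0] at hk; simp at hk
  · intro a ha b hb hab
    rw [mem_support_iff, hc] at ha hb
    have ha' : a < 3 * p := by by_contra h; simp [h] at ha
    have hb' : b < 3 * p := by by_contra h; simp [h] at hb
    have : a ≡ b [MOD 3 * p] := Nat.ModEq.add_right_cancel' (6 * u) hab
    exact Nat.ModEq.eq_of_lt_of_lt this ha' hb'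
  · intro e he
    simp only [Finset.mem_filter, Finset.mem_range] at he
    have key : ((e + (3 * p - 6 * u)) % (3 * p) + 6 * u) % (3 * p) = e := by
      rw [Nat.mod_add_mod, show e + (3 * p - 6 * u) + 6 * u = e + 3 * p by omega,
        Nat.add_mod_right, Nat.mod_eq_of_lt he.1]
    refine ⟨(e + (3 * p - 6 * u)) % (3 * p), ?_, key⟩
    rw [mem_support_iff, hc, if_pos (Nat.mod_lt _ (by omega)), key]
    exact he.2

/-- nonzero pattern -/
def pat (e : ℕ) : Prop := e % 6 = 0 ∨ e % 6 = 1 ∨ e % 6 = 3 ∨ e % 6 = 4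

instance : DecidablePred pat := fun _ => by unfold pat; infer_instance

lemma count_pat (N : ℕ) : 
    Nat.count pat N = (N + 5) / 6 + (N + 4) / 6 + (N + 2) / 6 + (N + 1) / 6 := by
  induction N with
  | zero => simp
  | succ N ih =>
    rw [Nat.count_succ, ih]
    by_cases h : pat N
    · rw [if_pos h]; unfold pat at h; omega
    · rw [if_neg h]; unfold pat at h; omega

lemma count_congr' {P Q : ℕ → Prop} [DecidablePred P] [DecidablePred Q] (n : ℕ)
    (h : ∀ k < n, (P k ↔ Q k)) : Nat.count P n = Nat.count Q n := by
  rw [Nat.count_eq_card_filter_range, Nat.count_eq_card_filter_range]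
  congr 1
  apply Finset.filter_congr
  intro k hk
  exact h k (Finset.mem_range.1 hk)

lemma count_zero' {P : ℕ → Prop} [DecidablePred P] (n : ℕ)
    (h : ∀ k < n, ¬ P k) : Nat.count P n = 0 := by
  rw [Nat.count_eq_card_filter_range, Finset.card_eq_zero, Finset.filter_eq_empty_iff]
  intro k hk
  exact h k (Finset.mem_range.1 hk)

lemma count_step {P Q : ℕ → Prop} [DecidablePred P] [DecidablePred Q] (a b c : ℕ)
    (hc : c = a + b) (h : ∀ k < b, (P (a + k) ↔ Q k)) :
    Nat.count P c = Nat.count P a + Nat.count Q b := by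
  rw [hc, Nat.count_add, count_congr' b h]

lemma count_pat2 (N : ℕ) :
    Nat.count (fun k => pat (2 + k)) N + 2 = Nat.count pat (2 + N) := by
  rw [Nat.count_add, count_pat 2, add_comm]

set_option maxHeartbeats 2000000 in
lemma count1 (s u : ℕ) (h : u + 1 ≤ s) :
    Nat.count (fun e => HH (6 * s + 1) u e ≠ 0) (3 * (6 * s + 1)) = 8 * u + 6 := by
  have t1 := count_congr' (P := fun e => HH (6 * s + 1) u e ≠ 0) (Q := pat) (6 * u + 2) (by
    intro k hk
    simp only [HH, gg, pat]
    push_cast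
    split_ifs <;> omega)
  have t2 := count_step (P := fun e => HH (6 * s + 1) u e ≠ 0) (Q := fun _ => True)
    (6 * u + 2) 1 (6 * u + 3) (by omega) (by
    intro k hk
    simp only [HH, gg, iff_true, iff_false, ne_eq, not_not]
    push_cast
    split_ifs <;> omega)
  have t3 := count_step (P := fun e => HH (6 * s + 1) u e ≠ 0) (Q := fun _ => False)
    (6 * u + 3) (6 * s + 1 - (6 * u + 3)) (6 * s + 1) (by omega) (by
    intro k hk
    simp only [HH, gg, iff_true, iff_false, ne_eq, not_not]
    push_cast
    split_ifs <;> omega)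
  have t4 := count_step (P := fun e => HH (6 * s + 1) u e ≠ 0) (Q := pat)
    (6 * s + 1) (6 * u + 2) (6 * s + 6 * u + 3) (by omega) (by
    intro k hk
    simp only [HH, gg, pat]
    push_cast
    split_ifs <;> omega)
  have t5 := count_step (P := fun e => HH (6 * s + 1) u e ≠ 0) (Q := fun _ => True)
    (6 * s + 6 * u + 3) 1 (6 * s + 6 * u + 4) (by omega) (by
    intro k hk
    simp only [HH, gg, iff_true, iff_false, ne_eq, not_not]
    push_cast
    split_ifs <;> omega)
  have t6 := count_step (P := fun e => HH (6 * s + 1) u e ≠ 0) (Q := fun _ => False)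
    (6 * s + 6 * u + 4) (3 * (6 * s + 1) - (6 * s + 6 * u + 4)) (3 * (6 * s + 1)) (by omega) (by
    intro k hk
    simp only [HH, gg, iff_true, iff_false, ne_eq, not_not]
    push_cast
    split_ifs <;> omega)
  rw [t6, t5, t4, t3, t2, t1, Nat.count_true, Nat.count_false, Nat.count_false, count_pat]
  omega

set_option maxHeartbeats 2000000 in
lemma count2 (s u : ℕ) (h : s ≤ u) (h' : u + 1 ≤ 2 * s) :
    Nat.count (fun e => HH (6 * s + 1) u e ≠ 0) (3 * (6 * s + 1)) = 4 * u + 4 * s + 2 := by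
  have t1 := count_congr' (P := fun e => HH (6 * s + 1) u e ≠ 0) (Q := pat) (6 * s + 1) (by
    intro k hk
    simp only [HH, gg, pat]
    push_cast
    split_ifs <;> omega)
  have t2 := count_step (P := fun e => HH (6 * s + 1) u e ≠ 0) (Q := fun k => pat (2 + k))
    (6 * s + 1) (6 * u + 2 - (6 * s + 1)) (6 * u + 2) (by omega) (by
    intro k hk
    simp only [HH, gg, pat]
    push_cast
    split_ifs <;> omega)
  have t3 := count_step (P := fun e => HH (6 * s + 1) u e ≠ 0) (Q := fun _ => False)
    (6 * u + 2) 1 (6 * u + 3) (by omega) (by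
    intro k hk
    simp only [HH, gg, iff_true, iff_false, ne_eq, not_not]
    push_cast
    split_ifs <;> omega)
  have t4 := count_step (P := fun e => HH (6 * s + 1) u e ≠ 0) (Q := fun k => pat (2 + k))
    (6 * u + 3) (6 * s) (6 * s + 6 * u + 3) (by omega) (by
    intro k hk
    simp only [HH, gg, pat]
    push_cast
    split_ifs <;> omega)
  have t5 := count_step (P := fun e => HH (6 * s + 1) u e ≠ 0) (Q := fun _ => True)
    (6 * s + 6 * u + 3) 1 (6 * s + 6 * u + 4) (by omega) (by
    intro k hk
    simp only [HH, gg, iff_true, iff_false, ne_eq, not_not]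
    push_cast
    split_ifs <;> omega)
  have t6 := count_step (P := fun e => HH (6 * s + 1) u e ≠ 0) (Q := fun _ => False)
    (6 * s + 6 * u + 4) (3 * (6 * s + 1) - (6 * s + 6 * u + 4)) (3 * (6 * s + 1)) (by omega) (by
    intro k hk
    simp only [HH, gg, iff_true, iff_false, ne_eq, not_not]
    push_cast
    split_ifs <;> omega)
  have c1 := count_pat2 (6 * u + 2 - (6 * s + 1))
  have c2 := count_pat2 (6 * s)
  rw [count_pat (2 + (6 * u + 2 - (6 * s + 1)))] at c1
  rw [count_pat (2 + 6 * s)] at c2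
  rw [t6, t5, t4, t3, t2, t1, Nat.count_true, Nat.count_false, Nat.count_false,
    count_pat (6 * s + 1)]
  clear t1 t2 t3 t4 t5 t6
  generalize Nat.count (fun k => pat (2 + k)) (6 * u + 2 - (6 * s + 1)) = A at *
  generalize Nat.count (fun k => pat (2 + k)) (6 * s) = B at *
  obtain ⟨d, rfl⟩ : ∃ d, u = s + d := ⟨u - s, by omega⟩
  rw [show 2 + (6 * (s + d) + 2 - (6 * s + 1)) = 6 * d + 3 by omega] at c1
  have hA : A = 4 * d := by omega
  have hB : B = 4 * s := by omega
  omega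

theorem stmt13 (p₂ p₃ q₂ : ℕ) (hp₂ : p₂.Prime) (h3 : 3 < p₂) (hq₂ : 3 * q₂ + 1 = p₂)
    (hp₃ : p₃.Prime) (hgt : 3 * p₂ < p₃) (hmod : p₃ % (3 * p₂) = 2)
    (u i : ℕ) (hiv : i = 3 * u) (hi : i < p₂ - 1) :
    (u ≤ q₂ / 2 - 1 → hw (blockPoly (3 * p₂) p₃ i) = 8 * u + 6) ∧
    (q₂ / 2 ≤ u → u ≤ q₂ - 1 → hw (blockPoly (3 * p₂) p₃ i) = 4 * u + 2 * q₂ + 2) := by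
  have hodd := hp₂.eq_two_or_odd
  obtain ⟨s, hs⟩ : ∃ s, q₂ = 2 * s := ⟨q₂ / 2, by omega⟩
  have hp : p₂ = 6 * s + 1 := by omega
  subst hiv
  rw [hw_eq p₂ p₃ hp₂ h3 hp₃ hgt hmod u (by omega) (by omega), hp]
  refine ⟨fun h => count1 s u (by omega), fun h h' => ?_⟩
  rw [count2 s u (by omega) (by omega)]
  omega
end

section
/- Let p₂ > 3 be a prime with p₂ ≡ 2 (mod 3), set q₂ = (p₂ − 2)/3 (which is odd), and let p₃ be a prime with p₃ > 3p₂ and p₃ ≡ 2 (mod 3p₂). Let i = 3u + v with v ∈ {1, 2} and i < p₂ − 1. Then hw(f_{3p₂,p₃,i,0}) = 8(u + 1) if 0 ≤ u ≤ (q₂ − 1)/2, and hw(f_{3p₂,p₃,i,0}) = 4(u + 1 + (q₂ + 1)/2) if (q₂ + 1)/2 ≤ u ≤ q₂ − 1. -/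
open Polynomial

namespace Stmt17

/-- periodic coefficients of the inverse of `Φ_{3p}` as a power series -/
def e (p : ℕ) (n : ℤ) : ℤ :=
  (if n % (3 * p) < 3 then 1 else 0) - (if (p:ℤ) ≤ n % (3 * p) ∧ n % (3 * p) < p + 3 then 1 else 0)

lemma cyc_mul (p : ℕ) (hp : p.Prime) (h3 : 3 < p) :
    cyclotomic (3 * p) ℤ * (X ^ 2 + X + 1) = X ^ (2 * p) + X ^ p + 1 := by
  have h := cyclotomic_expand_eq_cyclotomic_mul (p := p) (n := 3) hp
    (fun h => by have := Nat.le_of_dvd (by norm_num) h; omega) ℤ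
  rw [cyclotomic_three] at h
  rw [← h]
  simp [← pow_mul, mul_comm]

lemma cyc_coeff (p : ℕ) (hp : p.Prime) (h3 : 3 < p) (t : ℕ) :
    (3 * t < p → (cyclotomic (3 * p) ℤ).coeff (3 * t) = 1) ∧
    (3 * t + 1 < p → (cyclotomic (3 * p) ℤ).coeff (3 * t + 1) = -1) ∧
    (3 * t + 2 < p → (cyclotomic (3 * p) ℤ).coeff (3 * t + 2) = 0) := by
  have h := cyc_mul p hp h3
  have hc : ∀ n, (cyclotomic (3 * p) ℤ * (X ^ 2 + X + 1)).coeff n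
      = (X ^ (2 * p) + X ^ p + 1 : ℤ[X]).coeff n := fun n => by rw [h]
  set A := cyclotomic (3 * p) ℤ with hA
  simp only [mul_add, mul_one, coeff_add, coeff_X_pow, coeff_one] at hc
  have h0 := hc 0
  have h1 := hc 1
  have hs : ∀ n, n + 2 < p → A.coeff n + A.coeff (n + 1) + A.coeff (n + 2) = 0 := by
    intro n hn
    have := hc (n + 2)
    rw [coeff_mul_X_pow, coeff_mul_X] at this
    rw [if_neg (by omega), if_neg (by omega), if_neg (by omega)] at this
    simpa using this
  have e0 : A.coeff 0 = 1 := by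
    rw [if_neg (by omega), if_neg (by omega)] at h0
    simpa [coeff_mul_X_pow'] using h0
  have e1 : A.coeff 1 = -1 := by
    rw [if_neg (by omega), if_neg (by omega), coeff_mul_X] at h1
    simp [coeff_mul_X_pow'] at h1
    linarith
  induction t with
  | zero =>
    refine ⟨fun _ => e0, fun _ => e1, fun _ => ?_⟩
    have := hs 0 (by omega)
    simp only [mul_zero, zero_add] at this ⊢
    linarith
  | succ t ih =>
    obtain ⟨i0, i1, i2⟩ := ih
    have a0 : 3 * (t + 1) < p → A.coeff (3 * (t + 1)) = 1 := by
      intro hh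
      have := hs (3 * t + 1) (by omega)
      rw [i1 (by omega), i2 (by omega)] at this
      rw [show 3 * (t + 1) = 3 * t + 1 + 2 by ring]
      linarith
    have a1 : 3 * (t + 1) + 1 < p → A.coeff (3 * (t + 1) + 1) = -1 := by
      intro hh
      have := hs (3 * t + 2) (by omega)
      rw [show 3 * t + 2 + 1 = 3 * (t + 1) by ring, a0 (by omega), i2 (by omega)] at this
      rw [show 3 * (t + 1) + 1 = 3 * t + 2 + 2 by ring]
      linarith
    refine ⟨a0, a1, fun hh => ?_⟩
    have := hs (3 * (t + 1)) (by omega)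
    rw [a0 (by omega), a1 (by omega)] at this
    linarith

lemma e_small (p : ℕ) (h3 : 3 < p) (n : ℤ) (h : -(2 * p) + 3 ≤ n) (h' : n < 3 * p) :
    e p n = (if 0 ≤ n ∧ n < 3 then 1 else 0) - (if 0 ≤ n - p ∧ n - p < 3 then 1 else 0) := by
  unfold e
  by_cases hn : 0 ≤ n
  · rw [Int.emod_eq_of_lt hn h']
    split_ifs <;> omega
  · have : n % (3 * p) = n + 3 * p := by
      rw [← Int.add_emod_right, Int.emod_eq_of_lt (by omega) (by omega)]
    rw [this]
    split_ifs <;> omega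

lemma e_congr (p : ℕ) (a b : ℤ) (h : a % (3 * p) = b % (3 * p)) : e p a = e p b := by
  unfold e; rw [h]

lemma E_mul (p : ℕ) (hp : p.Prime) (h3 : 3 < p) :
    ((cyclotomic (3 * p) ℤ : ℤ[X]) : PowerSeries ℤ) * PowerSeries.mk (fun n => e p n) = 1 := by
  have h1 : PowerSeries.mk (fun n => e p (n:ℤ)) * (1 - PowerSeries.X ^ (3 * p))
      = (PowerSeries.X ^ 2 + PowerSeries.X + 1) * (1 - PowerSeries.X ^ p) := by
    have : ((PowerSeries.X ^ 2 + PowerSeries.X + 1) * (1 - PowerSeries.X ^ p) : PowerSeries ℤ)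
      = PowerSeries.X ^ 2 + PowerSeries.X ^ 1 + PowerSeries.X ^ 0 - PowerSeries.X ^ (p + 2)
        - PowerSeries.X ^ (p + 1) - PowerSeries.X ^ p := by ring
    rw [this]
    ext n
    rw [mul_sub, mul_one]
    simp only [map_sub, map_add, PowerSeries.coeff_X_pow, PowerSeries.coeff_mul_X_pow',
      PowerSeries.coeff_mk]
    by_cases hn : 3 * p ≤ n
    · rw [if_pos hn, e_congr p (n : ℤ) ((n - 3 * p : ℕ) : ℤ)]
      · rw [if_neg (by omega), if_neg (by omega), if_neg (by omega), if_neg (by omega),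
          if_neg (by omega), if_neg (by omega)]
        simp
      · push_cast [hn]
        simp
    · rw [if_neg hn, e_small p h3 n (by omega) (by omega)]
      split_ifs <;> omega
  have h2 : ((cyclotomic (3 * p) ℤ : ℤ[X]) : PowerSeries ℤ)
      * (PowerSeries.X ^ 2 + PowerSeries.X + 1)
      = PowerSeries.X ^ (2 * p) + PowerSeries.X ^ p + 1 := by
    have := congrArg (fun f : ℤ[X] => (f : PowerSeries ℤ)) (cyc_mul p hp h3)
    simpa using this
  have h3 : (1 - PowerSeries.X ^ (3 * p) : PowerSeries ℤ) ≠ 0 := by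
    intro h
    have := congrArg (PowerSeries.coeff 0) h
    rw [map_sub, PowerSeries.coeff_X_pow, if_neg (by omega)] at this
    simp at this
  apply mul_right_cancel₀ h3
  rw [mul_assoc, h1, ← mul_assoc, h2]
  ring

lemma coeff_block (p P : ℕ) (hp : p.Prime) (h3 : 3 < p) (hP : P.Prime) (hgt : 3 * p < P)
    (i k : ℕ) (hk : k < 3 * p) :
    (cyclotomic (3 * p * P) ℤ).coeff (i * P + k) =
      ∑ j ∈ Finset.range (i + 1),
        (cyclotomic (3 * p) ℤ).coeff j * e p (((i - j : ℕ) : ℤ) * P + k) := by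
  have h := cyclotomic_expand_eq_cyclotomic_mul (p := P) (n := 3 * p) hP
    (fun h => by have := Nat.le_of_dvd (by omega) h; omega) ℤ
  have h' : ((cyclotomic (3 * p * P) ℤ : ℤ[X]) : PowerSeries ℤ)
      = ((expand ℤ P (cyclotomic (3 * p) ℤ) : ℤ[X]) : PowerSeries ℤ)
        * PowerSeries.mk (fun n => e p n) := by
    rw [h, Polynomial.coe_mul, mul_assoc (_ : PowerSeries ℤ), E_mul p hp h3, mul_one]
  have hPpos := hP.pos
  rw [← Polynomial.coeff_coe, h', PowerSeries.coeff_mul,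
    Finset.Nat.sum_antidiagonal_eq_sum_range_succ_mk]
  symm
  apply Finset.sum_of_injOn (fun j => j * P)
  · intro a _ b _ hab
    exact Nat.eq_of_mul_eq_mul_right hPpos hab
  · intro j hj
    simp only [Finset.coe_range, Set.mem_Iio] at hj ⊢
    have : j * P ≤ i * P := Nat.mul_le_mul_right _ (by omega)
    show j * P < _
    omega
  · intro n hn hn'
    simp only [Polynomial.coeff_coe, coeff_expand hPpos]
    split_ifs with hd
    · exfalso
      obtain ⟨j, rfl⟩ := hd
      apply hn'
      refine ⟨j, ?_, mul_comm _ _⟩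
      simp only [Finset.coe_range, Set.mem_Iio, Finset.mem_range] at hn ⊢
      by_contra hc
      have : (i + 1) * P ≤ j * P := Nat.mul_le_mul_right _ (by omega)
      have e1 : (i + 1) * P = i * P + P := by ring
      have e2 : j * P = P * j := by ring
      omega
    · simp
  · intro j hj
    have hj' : j ≤ i := by simp at hj; omega
    have : j * P ≤ i * P := Nat.mul_le_mul_right _ hj'
    simp only [Polynomial.coeff_coe, coeff_expand_mul hPpos, PowerSeries.coeff_mk]
    congr 2
    push_cast [hj', show j * P ≤ i * P + k by omega]
    ring

lemma sum_trunc (p : ℕ) (hp : p.Prime) (h3 : 3 < p) (w : ℕ → ℤ) (u v : ℕ)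
    (hv : v = 1 ∨ v = 2) (hi : 3 * u + v < p) :
    ∑ j ∈ Finset.range (3 * u + v + 1), (cyclotomic (3 * p) ℤ).coeff j * w j
      = ∑ t ∈ Finset.range (u + 1), (w (3 * t) - w (3 * t + 1)) := by
  have key : ∀ n, 3 * n ≤ p → ∑ j ∈ Finset.range (3 * n), (cyclotomic (3 * p) ℤ).coeff j * w j
      = ∑ t ∈ Finset.range n, (w (3 * t) - w (3 * t + 1)) := by
    intro n
    induction n with
    | zero => simp
    | succ n ih =>
      intro hn
      obtain ⟨i0, i1, i2⟩ := cyc_coeff p hp h3 n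
      rw [show 3 * (n + 1) = 3 * n + 1 + 1 + 1 by ring, Finset.sum_range_succ,
        Finset.sum_range_succ, Finset.sum_range_succ, ih (by omega), i0 (by omega), i1 (by omega),
        i2 (by omega), Finset.sum_range_succ]
      ring
  obtain ⟨i0, i1, i2⟩ := cyc_coeff p hp h3 u
  rcases hv with rfl | rfl
  · rw [Finset.sum_range_succ, Finset.sum_range_succ, key u (by omega), i0 (by omega),
      i1 (by omega), Finset.sum_range_succ]
    ring
  · rw [Finset.sum_range_succ, show 3 * u + 2 = 3 * u + 1 + 1 by ring, Finset.sum_range_succ,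
      Finset.sum_range_succ, key u (by omega), i0 (by omega),
      i1 (by omega), i2 (by omega), Finset.sum_range_succ]
    ring

def b (p u : ℕ) (r : ℤ) : ℤ :=
  ∑ t ∈ Finset.range (u + 1), (e p (r - 6 * t) - e p (r - 6 * t - 2))

lemma coeff_eq_b (p P : ℕ) (hp : p.Prime) (h3 : 3 < p) (hP : P.Prime) (hgt : 3 * p < P)
    (hmod : P % (3 * p) = 2) (u v k : ℕ) (hv : v = 1 ∨ v = 2) (hi : 3 * u + v < p)
    (hk : k < 3 * p) :
    (cyclotomic (3 * p * P) ℤ).coeff ((3 * u + v) * P + k)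
      = b p u ((2 * (3 * u + v) + k : ℕ) : ℤ) := by
  rw [coeff_block p P hp h3 hP hgt _ _ hk, sum_trunc p hp h3
    (fun j => e p (((3 * u + v - j : ℕ) : ℤ) * P + k)) u v hv hi]
  unfold b
  have hm : (P : ℤ) ≡ 2 [ZMOD (3 * p : ℤ)] := by
    have : P ≡ 2 [MOD 3 * p] := by
      rw [Nat.ModEq, hmod, Nat.mod_eq_of_lt (by omega)]
    exact_mod_cast (Int.natCast_modEq_iff.mpr this)
  have hw : ∀ c k r : ℤ, r = c * 2 + k → e p (c * P + k) = e p r := by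
    intro c k r hr
    apply e_congr
    rw [hr]
    exact ((hm.mul_left c).add_right k)
  apply Finset.sum_congr rfl
  intro t ht
  have ht : t ≤ u := by simp at ht; omega
  congr 1
  · apply hw
    push_cast [show 3 * t ≤ 3 * u + v by omega]
    ring
  · apply hw
    push_cast [show 3 * t + 1 ≤ 3 * u + v by omega]
    ring

/-- closed form of the truncated sum -/
def G (U : ℕ) (r : ℤ) : ℤ :=
  if 0 ≤ r ∧ r < 6 * U then
    (if r % 6 = 0 ∨ r % 6 = 1 then 1 else if r % 6 = 3 ∨ r % 6 = 4 then -1 else 0)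
  else 0

lemma G_eq (U : ℕ) (r : ℤ) :
    ∑ t ∈ Finset.range U, ((if 0 ≤ r - 6 * t ∧ r - 6 * t < 3 then (1:ℤ) else 0)
      - (if 0 ≤ r - 6 * t - 2 ∧ r - 6 * t - 2 < 3 then 1 else 0)) = G U r := by
  induction U with
  | zero => 
    simp only [Finset.range_zero, Finset.sum_empty, G]
    rw [if_neg (by push_cast; omega)]
  | succ U ih =>
    rw [Finset.sum_range_succ, ih]
    unfold G
    push_cast
    split_ifs <;> omega

lemma b_eq (p u : ℕ) (h3 : 3 < p) (hu : 6 * u + 5 ≤ 2 * p) (r : ℤ) (h0 : 0 ≤ r)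
    (hr : r < 3 * p) : b p u r = G (u + 1) r - G (u + 1) (r - p) := by
  rw [← G_eq, ← G_eq, ← Finset.sum_sub_distrib]
  unfold b
  apply Finset.sum_congr rfl
  intro t ht
  have ht : t ≤ u := by simp at ht; omega
  rw [e_small p h3 _ (by omega) (by omega), e_small p h3 _ (by omega) (by omega)]
  rw [show r - p - 6 * t = r - 6 * t - p by ring, show r - 6 * t - 2 - p = r - 6 * t - p - 2 by ring]
  ring

lemma b_periodic (p u : ℕ) : Function.Periodic (fun r : ℕ => b p u (r : ℤ) ≠ 0) (3 * p) := by
  intro r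
  have : b p u ((r + 3 * p : ℕ) : ℤ) = b p u r := by
    unfold b
    apply Finset.sum_congr rfl
    intro t _
    congr 1
    · apply e_congr
      push_cast
      rw [show (r:ℤ) + 3 * p - 6 * t = r - 6 * t + 3 * p by ring, Int.add_emod_right]
    · apply e_congr
      push_cast
      rw [show (r:ℤ) + 3 * p - 6 * t - 2 = r - 6 * t - 2 + 3 * p by ring, Int.add_emod_right]
  simp only [this]

lemma sum3 (f : ℕ → ℕ) (n : ℕ) : ∑ r ∈ Finset.range (3 * n), f r
    = ∑ a ∈ Finset.range n, f (3 * a) + ∑ a ∈ Finset.range n, f (3 * a + 1)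
      + ∑ a ∈ Finset.range n, f (3 * a + 2) := by
  induction n with
  | zero => simp
  | succ n ih =>
    rw [show 3 * (n + 1) = 3 * n + 1 + 1 + 1 by ring]
    simp only [Finset.sum_range_succ, ih]
    ring

lemma G_ne (p q U : ℕ) (hq : 3 * q + 2 = p) (hodd : p % 2 = 1) (r : ℕ) :
    (G U r - G U (r - p) ≠ 0) ↔
      ((r < 6 * U ∧ r < p ∧ r % 3 ≠ 2) ∨ (r < 6 * U ∧ p ≤ r ∧ r % 3 ≠ 0) ∨
       (6 * U ≤ r ∧ p ≤ r ∧ r < p + 6 * U ∧ r % 3 ≠ 1)) := by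
  have h6 : p % 6 = 5 := by omega
  have h6' : ((r : ℤ) - p) % 6 = ((r : ℤ) + 1) % 6 := by omega
  unfold G
  rw [h6']
  split_ifs <;> omega

lemma count_G (p q U : ℕ) (hq : 3 * q + 2 = p) (hodd : p % 2 = 1) (hU : U ≤ q) :
    ((Finset.range (3 * p)).filter (fun r : ℕ => G U r - G U (r - p) ≠ 0)).card
      = 4 * U + 2 * min (2 * U) (q + 1) := by
  rw [Finset.card_filter, sum3, ← Finset.card_filter, ← Finset.card_filter, ← Finset.card_filter]
  have c0 : (Finset.range p).filter (fun a : ℕ => G U ((3 * a : ℕ) : ℤ) - G U (((3 * a : ℕ) : ℤ) - p) ≠ 0)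
      = Finset.range (min (2 * U) (q + 1)) ∪ Finset.Ico (max (2 * U) (q + 1)) (q + 1 + 2 * U) := by
    ext a
    rw [Finset.mem_filter, G_ne p q U hq hodd]
    simp only [Finset.mem_range, Finset.mem_union, Finset.mem_Ico]
    omega
  have c1 : (Finset.range p).filter (fun a : ℕ => G U ((3 * a + 1 : ℕ) : ℤ) - G U (((3 * a + 1 : ℕ) : ℤ) - p) ≠ 0)
      = Finset.range (2 * U) := by
    ext a
    rw [Finset.mem_filter, G_ne p q U hq hodd]
    simp only [Finset.mem_range]
    omega
  have c2 : (Finset.range p).filter (fun a : ℕ => G U ((3 * a + 2 : ℕ) : ℤ) - G U (((3 * a + 2 : ℕ) : ℤ) - p) ≠ 0)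
      = Finset.Ico q (q + 2 * U) := by
    ext a
    rw [Finset.mem_filter, G_ne p q U hq hodd]
    simp only [Finset.mem_range, Finset.mem_Ico]
    omega
  rw [c0, c1, c2, Finset.card_union_of_disjoint]
  · simp only [Finset.card_range, Nat.card_Ico]
    omega
  · rw [Finset.disjoint_left]
    intro a
    simp only [Finset.mem_range, Finset.mem_Ico]
    omega

lemma hw_block (m P i : ℕ) : hw (blockPoly m P i) =
    ((Finset.range m).filter (fun k => (cyclotomic (m * P) ℤ).coeff (i * P + k) ≠ 0)).card := by
  unfold hw blockPoly
  congr 1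
  ext n
  simp [mem_support_iff, finset_sum_coeff, coeff_C_mul, coeff_X_pow]

lemma main (p P q : ℕ) (hp : p.Prime) (h3 : 3 < p) (hq : 3 * q + 2 = p)
    (hP : P.Prime) (hgt : 3 * p < P) (hmod : P % (3 * p) = 2)
    (u v : ℕ) (hv : v = 1 ∨ v = 2) (hi : 3 * u + v < p - 1) :
    hw (blockPoly (3 * p) P (3 * u + v)) = 4 * (u + 1) + 2 * min (2 * (u + 1)) (q + 1) := by
  have hodd : p % 2 = 1 := (hp.eq_two_or_odd).resolve_left (by omega)
  rw [← count_G p q (u + 1) hq hodd (by omega), hw_block]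
  have s1 : (Finset.range (3 * p)).filter (fun k => (cyclotomic (3 * p * P) ℤ).coeff ((3 * u + v) * P + k) ≠ 0)
      = (Finset.range (3 * p)).filter (fun k => b p u ((2 * (3 * u + v) + k : ℕ) : ℤ) ≠ 0) := by
    apply Finset.filter_congr
    intro k hk
    rw [coeff_eq_b p P hp h3 hP hgt hmod u v k hv (by omega) (Finset.mem_range.mp hk)]
  have s2 : (Finset.range (3 * p)).filter (fun r : ℕ => G (u + 1) r - G (u + 1) (r - p) ≠ 0)
      = (Finset.range (3 * p)).filter (fun r : ℕ => b p u (r : ℤ) ≠ 0) := by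
    apply Finset.filter_congr
    intro r hr
    have := Finset.mem_range.mp hr
    rw [b_eq p u h3 (by omega) r (by omega) (by omega)]
  rw [s1, s2]
  have := Nat.filter_Ico_card_eq_of_periodic (2 * (3 * u + v)) (3 * p)
    (fun r : ℕ => b p u (r : ℤ) ≠ 0) (b_periodic p u)
  rw [← Nat.count_eq_card_filter_range (fun r : ℕ => b p u (r : ℤ) ≠ 0), ← this, Finset.card_filter, Finset.card_filter,
    Finset.sum_Ico_eq_sum_range]
  simp

end Stmt17

theorem stmt17 (p₂ p₃ q₂ : ℕ) (hp₂ : p₂.Prime) (h3 : 3 < p₂) (hq₂ : 3 * q₂ + 2 = p₂)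
    (hp₃ : p₃.Prime) (hgt : 3 * p₂ < p₃) (hmod : p₃ % (3 * p₂) = 2)
    (u v i : ℕ) (hv : v = 1 ∨ v = 2) (hiv : i = 3 * u + v) (hi : i < p₂ - 1) :
    (u ≤ (q₂ - 1) / 2 → hw (blockPoly (3 * p₂) p₃ i) = 8 * (u + 1)) ∧
    ((q₂ + 1) / 2 ≤ u → u ≤ q₂ - 1 →
      hw (blockPoly (3 * p₂) p₃ i) = 4 * (u + 1 + (q₂ + 1) / 2)) := by
  subst hiv
  have hodd : p₂ % 2 = 1 := (hp₂.eq_two_or_odd).resolve_left (by omega)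
  rw [Stmt17.main p₂ p₃ q₂ hp₂ h3 hq₂ hp₃ hgt hmod u v hv hi]
  constructor
  · intro h
    omega
  · intro h h'
    omega
end

section
/- Let p₂ > 3 be a prime with p₂ ≡ 2 (mod 3), set q₂ = (p₂ − 2)/3 (which is odd), and let p₃ be a prime with p₃ > 3p₂ and p₃ ≡ 2 (mod 3p₂); set q₃ = (p₃ − 2)/(3p₂). Let i = 3u + v with v ∈ {1, 2} and i < p₂ − 1. Then hw(f_{3p₂,p₃,i,q₃}) = 1 if 0 ≤ u ≤ (q₂ − 3)/2, and hw(f_{3p₂,p₃,i,q₃}) = v if u ≥ (q₂ − 1)/2. -/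
open Polynomial

/-- The last block `f_{3p₂,p₃,i,q₃}`: the polynomial of degree `< 2` whose coefficient of
`x^k` is the coefficient of `x^(i*p₃ + 3*p₂*q₃ + k)` in `Φ_{3p₂p₃}`, for `k = 0, 1`. -/
noncomputable def blockQ (p₂ p₃ i q₃ : ℕ) : Polynomial ℤ :=
  ∑ k ∈ Finset.range 2,
    C ((cyclotomic (3 * p₂ * p₃) ℤ).coeff (i * p₃ + 3 * p₂ * q₃ + k)) * X ^ k

theorem aux_expand (P : Polynomial ℤ) (W : PowerSeries ℤ) (p i r : ℕ) (hr : r < p) :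
    PowerSeries.coeff (i * p + r) (((expand ℤ p P : Polynomial ℤ) : PowerSeries ℤ) * W) =
      ∑ j ∈ Finset.range (i + 1), P.coeff j * PowerSeries.coeff ((i - j) * p + r) W := by
  have hp : 0 < p := by omega
  rw [PowerSeries.coeff_mul, Finset.Nat.sum_antidiagonal_eq_sum_range_succ
    (fun a b => PowerSeries.coeff a ((expand ℤ p P : Polynomial ℤ) : PowerSeries ℤ) *
      PowerSeries.coeff b W)]
  simp only [Polynomial.coeff_coe, coeff_expand hp]
  symm
  apply Finset.sum_of_injOn (fun j => j * p)
  · intro a _ b _ h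
    exact Nat.eq_of_mul_eq_mul_right hp h
  · intro j hj
    simp only [Finset.coe_range, Set.mem_Iio] at hj ⊢
    have : j * p ≤ i * p := Nat.mul_le_mul_right p (by omega)
    omega
  · intro n hn hnn
    rw [if_neg, zero_mul]
    rintro ⟨c, rfl⟩
    apply hnn
    simp only [Finset.mem_range] at hn
    refine ⟨c, ?_, by ring⟩
    simp only [Finset.coe_range, Set.mem_Iio]
    by_contra hc
    have : (i + 1) * p ≤ c * p := Nat.mul_le_mul_right p (by omega)
    nlinarith
  · intro j hj
    simp only [Finset.mem_range] at hj
    rw [if_pos (Dvd.intro_left j rfl), Nat.mul_div_cancel _ hp]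
    congr 3
    rw [Nat.sub_mul]
    have : j * p ≤ i * p := Nat.mul_le_mul_right p (by omega)
    omega

theorem aux_inv (m : ℕ) (hm : 1 < m) : ∃ W : PowerSeries ℤ,
    ((cyclotomic m ℤ : Polynomial ℤ) : PowerSeries ℤ) * W = 1 ∧
    ∀ n t, PowerSeries.coeff (n + m * t) W = PowerSeries.coeff n W := by
  have h0 : PowerSeries.constantCoeff ((cyclotomic m ℤ : Polynomial ℤ) : PowerSeries ℤ)
      = ((1 : ℤˣ) : ℤ) := by
    rw [Polynomial.constantCoeff_coe, cyclotomic_coeff_zero ℤ hm]; rfl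
  have hW := PowerSeries.mul_invOfUnit _ 1 h0
  generalize PowerSeries.invOfUnit ((cyclotomic m ℤ : Polynomial ℤ) : PowerSeries ℤ) 1 = W at hW
  refine ⟨W, hW, ?_⟩
  obtain ⟨Q, hQ⟩ := cyclotomic.dvd_X_pow_sub_one m ℤ
  have hdeg : Q.natDegree < m := by
    have h1 : ((X : ℤ[X]) ^ m - 1).natDegree = m := by
      simpa using natDegree_X_pow_sub_C (n := m) (r := (1 : ℤ))
    have hQ0 : Q ≠ 0 := by
      rintro rfl
      rw [hQ] at h1
      simp at h1
      omega
    rw [hQ, natDegree_mul (cyclotomic_ne_zero m ℤ) hQ0, natDegree_cyclotomic] at h1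
    have := Nat.totient_pos.2 (show 0 < m by omega)
    omega
  have key : W * (PowerSeries.X ^ m - 1) = (Q : PowerSeries ℤ) := by
    have : ((X ^ m - 1 : ℤ[X]) : PowerSeries ℤ) = PowerSeries.X ^ m - 1 := by simp
    rw [← this, hQ, Polynomial.coe_mul, ← mul_assoc, mul_comm W, hW, one_mul]
  have step : ∀ n, PowerSeries.coeff (n + m) W = PowerSeries.coeff n W := by
    intro n
    have := congrArg (PowerSeries.coeff (n + m)) key
    rw [mul_sub, mul_one, map_sub, PowerSeries.coeff_mul_X_pow, Polynomial.coeff_coe,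
      coeff_eq_zero_of_natDegree_lt (by omega)] at this
    linarith
  intro n t
  induction t with
  | zero => simp
  | succ t ih => rw [Nat.mul_succ, ← add_assoc, step, ih]

theorem aux_coeff (m p : ℕ) (hp : p.Prime) (hpm : ¬ p ∣ m) (W : PowerSeries ℤ)
    (hW : ((cyclotomic m ℤ : Polynomial ℤ) : PowerSeries ℤ) * W = 1) (i r : ℕ) (hr : r < p) :
    (cyclotomic (m * p) ℤ).coeff (i * p + r) =
      ∑ j ∈ Finset.range (i + 1),
        (cyclotomic m ℤ).coeff j * PowerSeries.coeff ((i - j) * p + r) W := by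
  rw [← aux_expand _ _ _ _ _ hr, cyclotomic_expand_eq_cyclotomic_mul hp hpm, Polynomial.coe_mul,
    mul_assoc, hW, mul_one, Polynomial.coeff_coe]

def w6 (n : ℕ) : ℤ :=
  if n % 6 = 0 ∨ n % 6 = 1 then 1 else if n % 6 = 3 ∨ n % 6 = 4 then -1 else 0

theorem aux_w6 : ((cyclotomic 6 ℤ : Polynomial ℤ) : PowerSeries ℤ) * PowerSeries.mk w6 = 1 := by
  rw [cyclotomic_six]
  ext n
  simp only [Polynomial.coe_add, Polynomial.coe_sub, Polynomial.coe_pow, Polynomial.coe_X,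
    Polynomial.coe_one]
  simp only [add_mul, sub_mul, one_mul, map_add, map_sub, pow_two, mul_assoc,
    PowerSeries.coeff_one]
  rcases n with _ | _ | n
  · simp [w6]
  · simp [w6, PowerSeries.coeff_succ_X_mul]
  · simp only [PowerSeries.coeff_succ_X_mul, PowerSeries.coeff_mk]
    have : n % 6 < 6 := Nat.mod_lt _ (by norm_num)
    simp only [w6]
    split_ifs <;> first | contradiction | rfl | omega

theorem aux_hw (a b : ℤ) : hw (∑ k ∈ Finset.range 2, Polynomial.C (if k = 0 then a else b) *
    Polynomial.X ^ k) = (if a = 0 then 0 else 1) + (if b = 0 then 0 else 1) := by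
  simp only [Finset.sum_range_succ, Finset.sum_range_zero, hw]
  simp only [zero_add, if_true, pow_zero, mul_one, one_ne_zero, if_false, pow_one]
  by_cases ha : a = 0
  · by_cases hb : b = 0
    · simp [ha, hb]
    · simp [-eq_intCast, ha, hb, Polynomial.support_C_mul_X]
  · by_cases hb : b = 0
    · simp [-eq_intCast, ha, hb, Polynomial.support_C ha]
    · have : (Polynomial.C a + Polynomial.C b * Polynomial.X).support = {0, 1} := by
        ext n
        rw [Polynomial.mem_support_iff, Polynomial.coeff_add, Polynomial.coeff_C_mul]
        rcases n with _ | _ | n <;>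
          simp [-eq_intCast, Polynomial.coeff_C, Polynomial.coeff_X, ha, hb]
      rw [this]; simp [ha, hb]

theorem stmt19 (p₂ p₃ q₂ q₃ : ℕ) (hp₂ : p₂.Prime) (h3 : 3 < p₂) (hq₂ : 3 * q₂ + 2 = p₂)
    (hp₃ : p₃.Prime) (hgt : 3 * p₂ < p₃) (hmod : p₃ % (3 * p₂) = 2)
    (hq₃ : 3 * p₂ * q₃ + 2 = p₃)
    (u v i : ℕ) (hv : v = 1 ∨ v = 2) (hiv : i = 3 * u + v) (hi : i < p₂ - 1) :
    -- `2 * u + 3 ≤ q₂` expresses `u ≤ (q₂ - 3)/2` (with `q₂` odd) without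
    -- truncated natural subtraction
    (2 * u + 3 ≤ q₂ → hw (blockQ p₂ p₃ i q₃) = 1) ∧
    ((q₂ - 1) / 2 ≤ u → hw (blockQ p₂ p₃ i q₃) = v) := by
  have hodd : p₂ % 2 = 1 := by
    rcases hp₂.eq_two_or_odd with h | h <;> omega
  have hodd3 : p₃ % 2 = 1 := by
    rcases hp₃.eq_two_or_odd with h | h <;> omega
  have hpm : ¬ p₃ ∣ 3 * p₂ := fun h => by
    have := Nat.le_of_dvd (by omega) h
    omega
  have h2m : ¬ 2 ∣ 3 * p₂ := by omega
  have hp6 : ¬ p₂ ∣ 6 := fun h => by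
    have := Nat.le_of_dvd (by norm_num) h
    interval_cases p₂ <;> omega
  obtain ⟨W, hW, hper⟩ := aux_inv (3 * p₂) (by omega)
  have h1 : ∀ k, k < 2 → (cyclotomic (3 * p₂ * p₃) ℤ).coeff (i * p₃ + 3 * p₂ * q₃ + k) =
      (cyclotomic (6 * p₂) ℤ).coeff (i * 2 + k) := by
    intro k hk
    have e : 6 * p₂ = 3 * p₂ * 2 := by ring
    rw [add_assoc, aux_coeff (3 * p₂) p₃ hp₃ hpm W hW i (3 * p₂ * q₃ + k) (by omega), e,
      aux_coeff (3 * p₂) 2 Nat.prime_two h2m W hW i k hk]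
    refine Finset.sum_congr rfl fun j _ => ?_
    congr 1
    rw [← hper ((i - j) * 2 + k) ((i - j + 1) * q₃)]
    congr 2
    conv_lhs => rw [← hq₃]
    ring
  have h2 : ∀ n, n < p₂ → (cyclotomic (6 * p₂) ℤ).coeff n = w6 n := by
    intro n hn
    have := aux_coeff 6 p₂ hp₂ hp6 _ aux_w6 0 n hn
    simpa [cyclotomic_six] using this
  have h3b : ∀ r, r < p₂ → (cyclotomic (6 * p₂) ℤ).coeff (p₂ + r) = w6 (p₂ + r) - w6 r := by
    intro r hr
    have := aux_coeff 6 p₂ hp₂ hp6 _ aux_w6 1 r hr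
    simp [cyclotomic_six, Finset.sum_range_succ, coeff_X, coeff_one] at this
    rw [this]; ring
  have h4 : ∀ n, n < 2 * p₂ → ((cyclotomic (6 * p₂) ℤ).coeff n = 0 ↔
      (n < p₂ ∧ n % 3 = 2 ∨ p₂ ≤ n ∧ n % 3 = 0)) := by
    intro n hn
    rcases lt_or_ge n p₂ with h | h
    · rw [h2 n h]
      unfold w6
      split_ifs <;> simp <;> omega
    · obtain ⟨r, rfl⟩ := Nat.exists_eq_add_of_le h
      rw [h3b r (by omega)]
      unfold w6
      split_ifs <;> simp <;> omega
  have hb : hw (blockQ p₂ p₃ i q₃) =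
      (if (cyclotomic (6 * p₂) ℤ).coeff (i * 2) = 0 then 0 else 1) +
      (if (cyclotomic (6 * p₂) ℤ).coeff (i * 2 + 1) = 0 then 0 else 1) := by
    rw [← aux_hw]
    congr 1
    unfold blockQ
    refine Finset.sum_congr rfl fun k hk => ?_
    rw [Finset.mem_range] at hk
    rw [h1 k hk]
    interval_cases k <;> simp
  rw [hb]
  simp only [h4 (i * 2) (by omega), h4 (i * 2 + 1) (by omega)]
  constructor
  · intro hu
    split_ifs <;> omega
  · intro hu
    split_ifs <;> omega
end
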